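/- Let m_1,…,m_n be a minimal generating set of a monomial ideal I of R, and suppose that for distinct indices i, j, l the generators are m_i = y^{b}z^{c}, m_l = y^{b'}z^{c'} and m_j = y^{b''}z^{c''} with b > b' > b'' ≥ 0 and 0 ≤ c < c' < c''. Then [m_i, m_l] = y^{b}z^{c'} and [m_l, m_j] = y^{b'}z^{c''} both strictly divide [m_i, m_j] = y^{b}z^{c''}, and consequently the S-pair σ associated with the pair {m_i, m_j} lies in 𝔪Z₂. -/

import Mathlib

open MvPolynomial

noncomputable section

/-- The trivariate polynomial ring `K[x,y,z]`, with variables indexed by `Fin 3`. -/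
abbrev PR (K : Type*) [Field K] : Type _ := MvPolynomial (Fin 3) K

/-- The monomial of `K[x,y,z]` with exponent vector `a : Fin 3 → ℕ`. -/
noncomputable def monom (K : Type*) [Field K] (a : Fin 3 → ℕ) : PR K :=
  ∏ t, X t ^ a t

/-- `m 0, …, m (n-1)` (given by their exponent vectors) form a minimal generating set of the
monomial ideal they generate: they are pairwise distinct and no one divides another.
(Divisibility of monomials is pointwise `≤` of exponent vectors, so non-divisibility for all
pairs of distinct indices already implies distinctness.) -/
def MinGen {n : ℕ} (m : Fin n → Fin 3 → ℕ) : Prop :=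
  ∀ i j, i ≠ j → ¬ m i ≤ m j

/-- Strict divisibility of monomials, in terms of exponent vectors: `a` divides `b` and `a ≠ b`. -/
def strictDvd (a b : Fin 3 → ℕ) : Prop := a ≤ b ∧ a ≠ b

/-- Strong divisibility of monomials: `a` divides `b / x_t` for every variable `x_t`
dividing `b`. -/
def strongDvd (a b : Fin 3 → ℕ) : Prop :=
  ∀ t, 0 < b t → a ≤ b - Pi.single t 1

/-- A monomial ideal (given by the exponent vectors of its minimal generators) is generic if
whenever two distinct minimal generators have the same positive exponent in some variable,
a third minimal generator strongly divides their lcm. -/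
def GenericI {n : ℕ} (m : Fin n → Fin 3 → ℕ) : Prop :=
  ∀ i j, i ≠ j → (∃ t, 0 < m i t ∧ m i t = m j t) →
    ∃ l, l ≠ i ∧ l ≠ j ∧ strongDvd (m l) (m i ⊔ m j)

/-- The homogeneous maximal ideal `𝔪 = (x,y,z)` of `K[x,y,z]`. -/
noncomputable def mxIdeal (K : Type*) [Field K] : Ideal (PR K) :=
  Ideal.span (Set.range X)

/-- The `R`-linear map `f₁ : Rⁿ → R` sending the `i`-th standard basis vector to the
monomial `m_i`. -/
noncomputable def syzF1 (K : Type*) [Field K] {n : ℕ} (m : Fin n → Fin 3 → ℕ) :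
    (Fin n → PR K) →ₗ[PR K] PR K where
  toFun v := ∑ i, v i * monom K (m i)
  map_add' u v := by simp [add_mul, Finset.sum_add_distrib]
  map_smul' c v := by simp [Finset.mul_sum, mul_assoc]

/-- The module `Z₂ = ker f₁` of second syzygies of `R/I`. -/
noncomputable def Z2 (K : Type*) [Field K] {n : ℕ} (m : Fin n → Fin 3 → ℕ) :
    Submodule (PR K) (Fin n → PR K) :=
  LinearMap.ker (syzF1 K m)

/-- The S-pair `σ_{ij} = (m_{ij}/m_j)·e_j − (m_{ij}/m_i)·e_i ∈ Rⁿ`. -/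
noncomputable def sigmaS (K : Type*) [Field K] {n : ℕ} (m : Fin n → Fin 3 → ℕ)
    (i j : Fin n) : Fin n → PR K :=
  Pi.single j (monom K ((m i ⊔ m j) - m j)) - Pi.single i (monom K ((m i ⊔ m j) - m i))

/-- `τ_{ijl} = (m_{ijl}/m_{ij})·e_{ij} − (m_{ijl}/m_{il})·e_{il} + (m_{ijl}/m_{jl})·e_{jl}`,
an element of the free module `F₂` with basis `e_{pq}` indexed by pairs. -/
noncomputable def tauS (K : Type*) [Field K] {n : ℕ} (m : Fin n → Fin 3 → ℕ)
    (i j l : Fin n) : Fin n × Fin n → PR K :=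
  Pi.single (i, j) (monom K ((m i ⊔ m j ⊔ m l) - (m i ⊔ m j)))
    - Pi.single (i, l) (monom K ((m i ⊔ m j ⊔ m l) - (m i ⊔ m l)))
    + Pi.single (j, l) (monom K ((m i ⊔ m j ⊔ m l) - (m j ⊔ m l)))

/-- The submodule `Z₃` of `F₂` generated by all `τ_{abc}` with `a < b < c`. -/
noncomputable def Z3 (K : Type*) [Field K] {n : ℕ} (m : Fin n → Fin 3 → ℕ) :
    Submodule (PR K) (Fin n × Fin n → PR K) :=
  Submodule.span (PR K) {v | ∃ a b c : Fin n, a < b ∧ b < c ∧ v = tauS K m a b c}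

theorem monom_add (K : Type*) [Field K] (a b : Fin 3 → ℕ) :
    monom K (a + b) = monom K a * monom K b := by
  simp [monom, pow_add, Finset.prod_mul_distrib]

/-- A monomial other than `1` lies in the homogeneous maximal ideal. -/
theorem monom_mem_mxIdeal (K : Type*) [Field K] {a : Fin 3 → ℕ} (ha : a ≠ 0) :
    monom K a ∈ mxIdeal K := by
  obtain ⟨t, ht⟩ := Function.ne_iff.mp ha
  refine Ideal.mem_of_dvd _ ?_ (Ideal.subset_span ⟨t, rfl⟩)
  exact (dvd_pow_self (X t : PR K) ht).trans
    (Finset.dvd_prod_of_mem (fun t => (X t : PR K) ^ a t) (Finset.mem_univ t))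

theorem strictDvd.monom_tsub_mem_mxIdeal (K : Type*) [Field K] {a b : Fin 3 → ℕ}
    (h : strictDvd a b) : monom K (b - a) ∈ mxIdeal K :=
  monom_mem_mxIdeal K fun h0 => h.2 (le_antisymm h.1 (tsub_eq_zero_iff_le.mp h0))

theorem syzF1_single (K : Type*) [Field K] {n : ℕ} (m : Fin n → Fin 3 → ℕ) (i : Fin n)
    (p : PR K) : syzF1 K m (Pi.single i p) = p * monom K (m i) := by
  simp [syzF1, Pi.single_apply]

theorem sigmaS_mem_Z2 (K : Type*) [Field K] {n : ℕ} (m : Fin n → Fin 3 → ℕ) (i j : Fin n) :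
    sigmaS K m i j ∈ Z2 K m := by
  rw [Z2, LinearMap.mem_ker, sigmaS, map_sub, syzF1_single, syzF1_single, ← monom_add,
    ← monom_add, tsub_add_cancel_of_le le_sup_right, tsub_add_cancel_of_le le_sup_left, sub_self]

/-- If `m_l` divides `[m_i,m_j]`, then `σ_{ij}` is a monomial combination of `σ_{il}` and
`σ_{lj}`. -/
theorem sigmaS_eq_smul_add_smul (K : Type*) [Field K] {n : ℕ} (m : Fin n → Fin 3 → ℕ)
    {i j l : Fin n} (h : m l ≤ m i ⊔ m j) :
    sigmaS K m i j = monom K ((m i ⊔ m j) - (m i ⊔ m l)) • sigmaS K m i l +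
      monom K ((m i ⊔ m j) - (m l ⊔ m j)) • sigmaS K m l j := by
  have hil : m i ⊔ m l ≤ m i ⊔ m j := sup_le le_sup_left h
  have hlj : m l ⊔ m j ≤ m i ⊔ m j := sup_le h le_sup_right
  simp only [sigmaS, smul_sub, ← Pi.single_smul, smul_eq_mul, ← monom_add,
    tsub_add_tsub_cancel hil le_sup_left, tsub_add_tsub_cancel hil le_sup_right,
    tsub_add_tsub_cancel hlj le_sup_left, tsub_add_tsub_cancel hlj le_sup_right]
  abel

/-- The S-pair of `m_i, m_j` lies in `𝔪Z₂` if some `m_l` is such that both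
`[m_i,m_l]` and `[m_l,m_j]` strictly divide `[m_i,m_j]`. -/
theorem sigmaS_mem_mxIdeal_smul_Z2 (K : Type*) [Field K] {n : ℕ} (m : Fin n → Fin 3 → ℕ)
    {i j l : Fin n} (hil : strictDvd (m i ⊔ m l) (m i ⊔ m j))
    (hlj : strictDvd (m l ⊔ m j) (m i ⊔ m j)) : sigmaS K m i j ∈ mxIdeal K • Z2 K m := by
  rw [sigmaS_eq_smul_add_smul K m (le_sup_right.trans hil.1)]
  exact add_mem
    (Submodule.smul_mem_smul (hil.monom_tsub_mem_mxIdeal K) (sigmaS_mem_Z2 K m i l))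
    (Submodule.smul_mem_smul (hlj.monom_tsub_mem_mxIdeal K) (sigmaS_mem_Z2 K m l j))

/-- If `m_i = y^b z^c`, `m_l = y^{b'}z^{c'}` and `m_j = y^{b''}z^{c''}` with
`b > b' > b'' ≥ 0` and `0 ≤ c < c' < c''` are minimal generators, then
`[m_i,m_l] = y^b z^{c'}` and `[m_l,m_j] = y^{b'}z^{c''}` both strictly divide
`[m_i,m_j] = y^b z^{c''}`, and consequently the S-pair of `m_i, m_j` lies in `𝔪Z₂`. -/
theorem stmt16 (K : Type*) [Field K] {n : ℕ} (m : Fin n → Fin 3 → ℕ) (hm : MinGen m)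
    (i j l : Fin n) (hij : i ≠ j) (hil : i ≠ l) (hjl : j ≠ l)
    (b b' b'' c c' c'' : ℕ) (hb1 : b > b') (hb2 : b' > b'') (hc1 : c < c') (hc2 : c' < c'')
    (hmi : m i = ![0, b, c]) (hml : m l = ![0, b', c']) (hmj : m j = ![0, b'', c'']) :
    m i ⊔ m l = ![0, b, c'] ∧ m l ⊔ m j = ![0, b', c''] ∧ m i ⊔ m j = ![0, b, c''] ∧
      strictDvd (m i ⊔ m l) (m i ⊔ m j) ∧ strictDvd (m l ⊔ m j) (m i ⊔ m j) ∧
      sigmaS K m i j ∈ mxIdeal K • Z2 K m := by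
  have sup_vec (p q r s : ℕ) :
      (![0, p, q] ⊔ ![0, r, s] : Fin 3 → ℕ) = ![0, p ⊔ r, q ⊔ s] := by
    ext t; fin_cases t <;> simp
  have eil : m i ⊔ m l = ![0, b, c'] := by
    rw [hmi, hml, sup_vec, sup_eq_left.mpr hb1.le, sup_eq_right.mpr hc1.le]
  have elj : m l ⊔ m j = ![0, b', c''] := by
    rw [hml, hmj, sup_vec, sup_eq_left.mpr hb2.le, sup_eq_right.mpr hc2.le]
  have eij : m i ⊔ m j = ![0, b, c''] := by
    rw [hmi, hmj, sup_vec, sup_eq_left.mpr (hb2.trans hb1).le,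
      sup_eq_right.mpr (hc1.trans hc2).le]
  have sil : strictDvd (m i ⊔ m l) (m i ⊔ m j) := by
    rw [eil, eij]
    refine ⟨fun t => ?_, fun h => hc2.ne (congrFun h 2)⟩
    fin_cases t <;> simp [hc2.le]
  have slj : strictDvd (m l ⊔ m j) (m i ⊔ m j) := by
    rw [elj, eij]
    refine ⟨fun t => ?_, fun h => hb1.ne (congrFun h 1)⟩
    fin_cases t <;> simp [hb1.le]
  exact ⟨eil, elj, eij, sil, slj, sigmaS_mem_mxIdeal_smul_Z2 K m sil slj⟩
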